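/- Let (E, {f_i}_{i=1}^m) ∈ 𝓔 with convex hull I. If f_{m−1}(I) ∩ f_m(I) = ∅, then dim_H (f_{m−1}(E) ∩ U_1(E)) = dim_H U_1(E). -/

import Mathlib

open Set Filter MeasureTheory

/-- A self-similar iterated function system on `ℝ` given by `m` similitudes
`f i x = r i * x + t i` (for `1 ≤ i ≤ m`, `m ≥ 3`), together with its attractor `E`:
the unique nonempty compact set with `E = ⋃_{i=1}^m f_i(E)`. -/
structure ClassE where
  m : ℕ
  r : ℕ → ℝ
  t : ℕ → ℝ
  E : Set ℝ
  hm : 3 ≤ m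
  hr : ∀ i, 1 ≤ i → i ≤ m → 0 < r i ∧ r i < 1
  hEne : E.Nonempty
  hEcpt : IsCompact E
  hEinv : E = ⋃ i ∈ Finset.Icc 1 m, (fun x => r i * x + t i) '' E

namespace ClassE

/-- The `i`-th similitude. -/
def f (S : ClassE) (i : ℕ) (x : ℝ) : ℝ := S.r i * x + S.t i

/-- Left endpoint `a` of the convex hull of `E`. -/
noncomputable def a (S : ClassE) : ℝ := sInf S.E

/-- Right endpoint `b` of the convex hull of `E`. -/
noncomputable def b (S : ClassE) : ℝ := sSup S.E

/-- The convex hull `I = [a, b]` of `E`. -/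
noncomputable def I (S : ClassE) : Set ℝ := Set.Icc S.a S.b

/-- Condition (A): `a = f_1(a) < f_2(a) < ⋯ < f_m(a) < f_m(b) = b`. -/
def condA (S : ClassE) : Prop :=
  S.f 1 S.a = S.a ∧ (∀ i, 1 ≤ i → i < S.m → S.f i S.a < S.f (i + 1) S.a) ∧
    S.f S.m S.a < S.f S.m S.b ∧ S.f S.m S.b = S.b

/-- Condition (B): `f_i(I) ∩ f_{i+2}(I) = ∅` for all `1 ≤ i ≤ m - 2`. -/
def condB (S : ClassE) : Prop :=
  ∀ i, 1 ≤ i → i + 2 ≤ S.m → S.f i '' S.I ∩ S.f (i + 2) '' S.I = ∅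

/-- Condition (C): there are `i, j ∈ {1, …, m-1}` with `f_i(I) ∩ f_{i+1}(I) = ∅` and
`f_j(I) ∩ f_{j+1}(I) ≠ ∅`. -/
def condC (S : ClassE) : Prop :=
  (∃ i, 1 ≤ i ∧ i + 1 ≤ S.m ∧ S.f i '' S.I ∩ S.f (i + 1) '' S.I = ∅) ∧
    (∃ j, 1 ≤ j ∧ j + 1 ≤ S.m ∧ S.f j '' S.I ∩ S.f (j + 1) '' S.I ≠ ∅)

/-- Condition (D): whenever `f_i(I) ∩ f_{i+1}(I) ≠ ∅` there are `u, v ≥ 1` with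
`f_i(I) ∩ f_{i+1}(I) = f_i ∘ f_m^u (I) = f_{i+1} ∘ f_1^v (I)`. -/
def condD (S : ClassE) : Prop :=
  ∀ i, 1 ≤ i → i + 1 ≤ S.m → S.f i '' S.I ∩ S.f (i + 1) '' S.I ≠ ∅ →
    ∃ u v : ℕ, 1 ≤ u ∧ 1 ≤ v ∧
      S.f i '' S.I ∩ S.f (i + 1) '' S.I = (S.f i ∘ (S.f S.m)^[u]) '' S.I ∧
      S.f i '' S.I ∩ S.f (i + 1) '' S.I = (S.f (i + 1) ∘ (S.f 1)^[v]) '' S.I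

/-- Membership in the class `𝓔`: conditions (A)–(D). -/
def goodE (S : ClassE) : Prop := S.condA ∧ S.condB ∧ S.condC ∧ S.condD

/-- `prefixMap d n = f_{d 0} ∘ f_{d 1} ∘ ⋯ ∘ f_{d (n-1)}`. -/
def prefixMap (S : ClassE) (d : ℕ → ℕ) : ℕ → ℝ → ℝ
  | 0 => id
  | n + 1 => S.prefixMap d n ∘ S.f (d n)

/-- `d : ℕ → ℕ` (with digits in `{1, …, m}`) is a coding of `x` if
`x = lim_n f_{d 0} ∘ ⋯ ∘ f_{d (n-1)} (0)`. -/
def isCoding (S : ClassE) (d : ℕ → ℕ) (x : ℝ) : Prop :=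
  (∀ n, 1 ≤ d n ∧ d n ≤ S.m) ∧
    Tendsto (fun n => S.prefixMap d n 0) atTop (nhds x)

/-- The set of codings of `x`. -/
def codings (S : ClassE) (x : ℝ) : Set (ℕ → ℕ) := {d | S.isCoding d x}

/-- `U k E`: the set of points of `E` having exactly `k` distinct codings
(`k` a cardinal; e.g. `k = ℵ₀` for countably infinitely many codings,
`k = 𝔠 = 2^ℵ₀` for a continuum of codings). -/
def U (S : ClassE) (k : Cardinal) : Set ℝ :=
  {x ∈ S.E | Cardinal.mk (S.codings x) = k}

end ClassE

open ClassE


namespace ClassE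

lemma aux_aff (S : ClassE) (i : ℕ) (hi : 1 ≤ i) (hi' : i ≤ S.m) (n : ℕ) :
    ∃ p q : ℝ, 0 < p ∧ ∀ x, (S.f i)^[n] x = p * x + q := by
  induction n with
  | zero => exact ⟨1, 0, one_pos, fun x => by simp⟩
  | succ n ih =>
    obtain ⟨p, q, hp, h⟩ := ih
    refine ⟨p * S.r i, p * S.t i + q, mul_pos hp (S.hr i hi hi').1, fun x => ?_⟩
    rw [Function.iterate_succ_apply, h, f]; ring

lemma aux_inj (S : ClassE) (i : ℕ) (hi : 1 ≤ i) (hi' : i ≤ S.m) {x y : ℝ}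
    (h : S.f i x = S.f i y) : x = y := by
  have := (S.hr i hi hi').1
  simp only [f] at h
  have h2 : S.r i * x = S.r i * y := by linarith
  exact mul_left_cancel₀ this.ne' h2

lemma aux_mono (S : ClassE) (i : ℕ) (hi : 1 ≤ i) (hi' : i ≤ S.m) {x y : ℝ}
    (h : x ≤ y) : S.f i x ≤ S.f i y := by
  have := (S.hr i hi hi').1
  simp only [f]
  nlinarith

lemma aux_mem (S : ClassE) {i : ℕ} (hi : 1 ≤ i) (hi' : i ≤ S.m) {x : ℝ} (hx : x ∈ S.E) :
    S.f i x ∈ S.E := by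
  rw [S.hEinv]
  simp only [mem_iUnion]
  exact ⟨i, Finset.mem_Icc.2 ⟨hi, hi'⟩, x, hx, rfl⟩

lemma aux_ex (S : ClassE) {x : ℝ} (hx : x ∈ S.E) :
    ∃ i y, 1 ≤ i ∧ i ≤ S.m ∧ y ∈ S.E ∧ x = S.f i y := by
  rw [S.hEinv] at hx
  simp only [mem_iUnion] at hx
  obtain ⟨i, hi, y, hy, h⟩ := hx
  exact ⟨i, y, (Finset.mem_Icc.1 hi).1, (Finset.mem_Icc.1 hi).2, hy, h.symm⟩

lemma aux_E_sub (S : ClassE) {x : ℝ} (hx : x ∈ S.E) : S.a ≤ x ∧ x ≤ S.b :=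
  ⟨csInf_le S.hEcpt.bddBelow hx, le_csSup S.hEcpt.bddAbove hx⟩

/-- prepend a digit -/
def aux_cons (j : ℕ) (d : ℕ → ℕ) : ℕ → ℕ
  | 0 => j
  | n + 1 => d n

lemma aux_prefix (S : ClassE) (d : ℕ → ℕ) (n : ℕ) (x : ℝ) :
    S.prefixMap d (n + 1) x = S.f (d 0) (S.prefixMap (fun k => d (k + 1)) n x) := by
  induction n generalizing x with
  | zero => rfl
  | succ n ih =>
    change S.prefixMap d (n + 1) (S.f (d (n + 1)) x) = _
    rw [ih]; rfl

lemma aux_cont (S : ClassE) (i : ℕ) : Continuous (S.f i) := by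
  unfold f; fun_prop

lemma aux_coding_cons (S : ClassE) {j : ℕ} (hj : 1 ≤ j) (hj' : j ≤ S.m) {d : ℕ → ℕ} {x : ℝ}
    (h : S.isCoding d x) : S.isCoding (aux_cons j d) (S.f j x) := by
  refine ⟨fun n => ?_, ?_⟩
  · cases n with
    | zero => exact ⟨hj, hj'⟩
    | succ n => exact h.1 n
  · rw [← tendsto_add_atTop_iff_nat 1]
    have := ((S.aux_cont j).tendsto x).comp h.2
    refine this.congr fun n => ?_
    rw [aux_prefix]; rfl

lemma aux_coding_tail (S : ClassE) {d : ℕ → ℕ} {x : ℝ}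
    (h : S.isCoding d x) : ∃ y, x = S.f (d 0) y ∧ S.isCoding (fun k => d (k + 1)) y := by
  have hr := (S.hr (d 0) (h.1 0).1 (h.1 0).2).1
  refine ⟨(x - S.t (d 0)) / S.r (d 0), ?_, fun n => h.1 (n + 1), ?_⟩
  · simp only [f]; field_simp; ring
  · have h2 := h.2
    rw [← tendsto_add_atTop_iff_nat 1] at h2
    have := (h2.sub_const (S.t (d 0))).div_const (S.r (d 0))
    refine this.congr fun n => ?_
    rw [aux_prefix, f]; field_simp; ring

lemma aux_R (S : ClassE) : ∃ R : ℝ, 0 ≤ R ∧ R < 1 ∧ ∀ i, 1 ≤ i → i ≤ S.m → S.r i ≤ R := by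
  have hne : (Finset.Icc 1 S.m).Nonempty := ⟨1, Finset.mem_Icc.2 ⟨le_rfl, by have := S.hm; omega⟩⟩
  obtain ⟨k, hk, hmax⟩ := Finset.exists_max_image (Finset.Icc 1 S.m) S.r hne
  have hk' := Finset.mem_Icc.1 hk
  exact ⟨S.r k, (S.hr k hk'.1 hk'.2).1.le, (S.hr k hk'.1 hk'.2).2,
    fun i hi hi' => hmax i (Finset.mem_Icc.2 ⟨hi, hi'⟩)⟩

lemma aux_contract (S : ClassE) {R : ℝ} (h0 : 0 ≤ R)
    (hR : ∀ i, 1 ≤ i → i ≤ S.m → S.r i ≤ R) (d : ℕ → ℕ) (hd : ∀ n, 1 ≤ d n ∧ d n ≤ S.m)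
    (n : ℕ) (x y : ℝ) : |S.prefixMap d n x - S.prefixMap d n y| ≤ R ^ n * |x - y| := by
  induction n generalizing x y with
  | zero => simp [prefixMap]
  | succ n ih =>
    change |S.prefixMap d n (S.f (d n) x) - S.prefixMap d n (S.f (d n) y)| ≤ _
    refine (ih _ _).trans ?_
    have e : S.f (d n) x - S.f (d n) y = S.r (d n) * (x - y) := by simp only [f]; ring
    rw [e, abs_mul, pow_succ, abs_of_pos (S.hr _ (hd n).1 (hd n).2).1, mul_assoc]
    have := hR _ (hd n).1 (hd n).2
    gcongr

lemma aux_tendsto (S : ClassE) (d : ℕ → ℕ) (hd : ∀ n, 1 ≤ d n ∧ d n ≤ S.m) (x : ℕ → ℝ)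
    (hx : ∀ n, x n ∈ S.E) :
    Tendsto (fun n => S.prefixMap d n (x n) - S.prefixMap d n 0) atTop (nhds 0) := by
  obtain ⟨R, h0, h1, hR⟩ := S.aux_R
  obtain ⟨C, hC⟩ := S.hEcpt.isBounded.exists_norm_le
  have ht : Tendsto (fun n => R ^ n * C) atTop (nhds 0) := by
    simpa using (tendsto_pow_atTop_nhds_zero_of_lt_one h0 h1).mul_const C
  refine squeeze_zero_norm (fun n => ?_) ht
  rw [Real.norm_eq_abs]
  refine (S.aux_contract h0 hR d hd n _ _).trans ?_
  have := hC _ (hx n)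
  rw [Real.norm_eq_abs] at this
  rw [sub_zero]
  gcongr

lemma aux_coding_mem (S : ClassE) {d : ℕ → ℕ} {x : ℝ} (h : S.isCoding d x) : x ∈ S.E := by
  obtain ⟨e, he⟩ := S.hEne
  have ht := (S.aux_tendsto d h.1 (fun _ => e) (fun _ => he)).add h.2
  simp only [sub_add_cancel, zero_add] at ht
  refine S.hEcpt.isClosed.mem_of_tendsto ht (Eventually.of_forall fun n => ?_)
  have : ∀ n, ∀ y ∈ S.E, S.prefixMap d n y ∈ S.E := by
    intro n
    induction n with
    | zero => intro y hy; exact hy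
    | succ n ih => intro y hy; exact ih _ (S.aux_mem (h.1 n).1 (h.1 n).2 hy)
  exact this n e he

lemma aux_coding_exists (S : ClassE) {x : ℝ} (hx : x ∈ S.E) : ∃ d, S.isCoding d x := by
  have key : ∀ y : S.E, ∃ (i : ℕ) (z : S.E), 1 ≤ i ∧ i ≤ S.m ∧ (y : ℝ) = S.f i z := by
    intro y
    obtain ⟨i, z, h1, h2, h3, h4⟩ := S.aux_ex y.2
    exact ⟨i, ⟨z, h3⟩, h1, h2, h4⟩
  choose g s h1 h2 h3 using key
  let xs : ℕ → S.E := fun n => s^[n] ⟨x, hx⟩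
  let d : ℕ → ℕ := fun n => g (xs n)
  have hd : ∀ n, 1 ≤ d n ∧ d n ≤ S.m := fun n => ⟨h1 _, h2 _⟩
  have hxs : ∀ n, S.prefixMap d n (xs n) = x := by
    intro n
    induction n with
    | zero => rfl
    | succ n ih =>
      change S.prefixMap d n (S.f (d n) (xs (n + 1))) = x
      have e : xs (n + 1) = s (xs n) := Function.iterate_succ_apply' _ _ _
      rw [e, ← h3, ih]
  refine ⟨d, hd, ?_⟩
  have ht := S.aux_tendsto d hd (fun n => xs n) (fun n => (xs n).2)
  simp only [hxs] at ht
  have := ht.const_sub x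
  simpa using this

lemma aux_U (S : ClassE) (x : ℝ) :
    x ∈ S.U 1 ↔ x ∈ S.E ∧ ∀ c d, S.isCoding c x → S.isCoding d x → c = d := by
  unfold U
  simp only [mem_ofPred_eq, Cardinal.eq_one_iff_unique]
  constructor
  · rintro ⟨h1, h2, h3⟩
    refine ⟨h1, fun c d hc hd => ?_⟩
    exact congrArg Subtype.val (h2.elim (⟨c, hc⟩ : S.codings x) ⟨d, hd⟩)
  · rintro ⟨h1, h2⟩
    obtain ⟨d, hd⟩ := S.aux_coding_exists h1
    exact ⟨h1, ⟨fun c d => Subtype.ext (h2 _ _ c.2 d.2)⟩, ⟨⟨d, hd⟩⟩⟩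

lemma aux_U_down (S : ClassE) {j : ℕ} (hj : 1 ≤ j) (hj' : j ≤ S.m) {x : ℝ} (hx : x ∈ S.E)
    (h : S.f j x ∈ S.U 1) : x ∈ S.U 1 := by
  rw [aux_U] at h ⊢
  refine ⟨hx, fun c d hc hd => ?_⟩
  have := h.2 _ _ (S.aux_coding_cons hj hj' hc) (S.aux_coding_cons hj hj' hd)
  funext n
  exact congrFun this (n + 1)

lemma aux_head (S : ClassE) {i j : ℕ} (hi : 1 ≤ i) (hi' : i ≤ S.m) (hj : 1 ≤ j) (hj' : j ≤ S.m)
    {x y z : ℝ} (hx : x ∈ S.U 1) (hy : y ∈ S.E) (hz : z ∈ S.E) (h1 : x = S.f i y)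
    (h2 : x = S.f j z) : i = j := by
  rw [aux_U] at hx
  obtain ⟨c, hc⟩ := S.aux_coding_exists hy
  obtain ⟨d, hd⟩ := S.aux_coding_exists hz
  have hc' := S.aux_coding_cons hi hi' hc
  have hd' := S.aux_coding_cons hj hj' hd
  rw [← h1] at hc'
  rw [← h2] at hd'
  exact congrFun (hx.2 _ _ hc' hd') 0

lemma aux_lt (S : ClassE) (hS : S.goodE) {i j : ℕ} (hi : 1 ≤ i) (hij : i < j) (hj : j ≤ S.m) :
    S.f i S.a < S.f j S.a := by
  induction j, hij using Nat.le_induction with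
  | base => exact hS.1.2.1 i hi (by omega)
  | succ k hk ih => exact (ih (by omega)).trans (hS.1.2.1 k (by omega) (by omega))

lemma aux_ab (S : ClassE) (hS : S.goodE) : S.a < S.b := by
  have h := hS.1.2.2.1
  by_contra hc
  exact absurd h (not_lt.2 (S.aux_mono S.m (by have := S.hm; omega) le_rfl (not_lt.1 hc)))

lemma aux_far (S : ClassE) (hS : S.goodE) {i j : ℕ} (hi : 1 ≤ i) (hij : i + 2 ≤ j)
    (hj : j ≤ S.m) {x y : ℝ} (hx : x ∈ S.I) (hy : y ∈ S.I) : S.f i x < S.f j y := by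
  have hB := hS.2.1 i hi (by omega)
  have hab := S.aux_ab hS
  have h1 : S.f i S.a < S.f (i + 2) S.a := S.aux_lt hS hi (by omega) (by omega)
  have h2 : S.f (i + 2) S.a ≤ S.f j S.a := by
    rcases hij.eq_or_lt with h | h
    · rw [h]
    · exact (S.aux_lt hS (by omega) h hj).le
  have h3 : S.f i S.b < S.f (i + 2) S.a := by
    by_contra hc
    push Not at hc
    have hr := (S.hr i hi (by omega)).1
    have : S.f (i + 2) S.a ∈ S.f i '' S.I ∩ S.f (i + 2) '' S.I := by
      refine ⟨⟨(S.f (i + 2) S.a - S.t i) / S.r i, ⟨?_, ?_⟩, ?_⟩, S.a, ⟨le_rfl, hab.le⟩, rfl⟩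
      · rw [le_div_iff₀ hr]
        have : S.f i S.a = S.r i * S.a + S.t i := rfl
        nlinarith
      · rw [div_le_iff₀ hr]
        have : S.f i S.b = S.r i * S.b + S.t i := rfl
        nlinarith
      · change S.r i * ((S.f (i + 2) S.a - S.t i) / S.r i) + S.t i = _
        field_simp; ring
    rw [hB] at this
    exact this
  have h4 := S.aux_mono i hi (by omega) hx.2
  have h5 := S.aux_mono j (by omega) hj hy.1
  linarith

lemma aux_maps (S : ClassE) {i : ℕ} (hi : 1 ≤ i) (hi' : i ≤ S.m) {x : ℝ}
    (hx : x ∈ S.E) (n : ℕ) : (S.f i)^[n] x ∈ S.E := by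
  induction n with
  | zero => exact hx
  | succ n ih => rw [Function.iterate_succ_apply']; exact S.aux_mem hi hi' ih

lemma aux_I_maps (S : ClassE) {i : ℕ} (hi : 1 ≤ i) (hi' : i ≤ S.m) {x : ℝ}
    (hx : x ∈ S.I) : S.f i x ∈ S.I := by
  have ha : S.a ∈ S.E := S.hEcpt.sInf_mem S.hEne
  have hb : S.b ∈ S.E := S.hEcpt.sSup_mem S.hEne
  exact ⟨(S.aux_E_sub (S.aux_mem hi hi' ha)).1.trans (S.aux_mono i hi hi' hx.1),
    (S.aux_mono i hi hi' hx.2).trans (S.aux_E_sub (S.aux_mem hi hi' hb)).2⟩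

lemma aux_I_iter (S : ClassE) {i : ℕ} (hi : 1 ≤ i) (hi' : i ≤ S.m) {x : ℝ}
    (hx : x ∈ S.I) (n : ℕ) : (S.f i)^[n] x ∈ S.I := by
  induction n with
  | zero => exact hx
  | succ n ih => rw [Function.iterate_succ_apply']; exact S.aux_I_maps hi hi' ih

lemma aux_icc {p q p' q' a b : ℝ} (hab : a < b) (hp : 0 < p) (hp' : 0 < p')
    (h : (fun x => p * x + q) '' Icc a b = (fun x => p' * x + q') '' Icc a b) :
    p = p' ∧ q = q' := by
  have k1 : ∀ {p q p' q' : ℝ}, 0 < p → 0 < p' →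
      (fun x => p * x + q) '' Icc a b = (fun x => p' * x + q') '' Icc a b →
      p' * a + q' ≤ p * a + q ∧ p * b + q ≤ p' * b + q' := by
    intro p q p' q' hp hp' h
    have e1 : p * a + q ∈ (fun x => p * x + q) '' Icc a b := ⟨a, ⟨le_rfl, hab.le⟩, rfl⟩
    have e2 : p * b + q ∈ (fun x => p * x + q) '' Icc a b := ⟨b, ⟨hab.le, le_rfl⟩, rfl⟩
    rw [h] at e1 e2
    obtain ⟨y, hy, e1⟩ := e1
    obtain ⟨z, hz, e2⟩ := e2
    simp only at e1 e2
    constructor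
    · nlinarith [hy.1]
    · nlinarith [hz.2]
  obtain ⟨h1, h2⟩ := k1 hp hp' h
  obtain ⟨h3, h4⟩ := k1 hp' hp h.symm
  have : (p - p') * (b - a) = 0 := by nlinarith
  have h5 : p = p' := by
    rcases mul_eq_zero.1 this with h | h <;> linarith
  subst h5
  exact ⟨rfl, by linarith⟩

/-- The two descriptions of an overlap agree as maps. -/
lemma aux_swap (S : ClassE) (hS : S.goodE) {i u v : ℕ} (hi : 1 ≤ i) (hi' : i + 1 ≤ S.m)
    (h : (S.f i ∘ (S.f S.m)^[u]) '' S.I = (S.f (i + 1) ∘ (S.f 1)^[v]) '' S.I) (x : ℝ) :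
    S.f i ((S.f S.m)^[u] x) = S.f (i + 1) ((S.f 1)^[v] x) := by
  obtain ⟨p, q, hp, h1⟩ := S.aux_aff S.m (by omega) le_rfl u
  obtain ⟨p', q', hp', h2⟩ := S.aux_aff 1 le_rfl (by omega) v
  have e1 : S.f i ∘ (S.f S.m)^[u] = fun x => (S.r i * p) * x + (S.r i * q + S.t i) := by
    funext x; simp only [Function.comp, h1, f]; ring
  have e2 : S.f (i + 1) ∘ (S.f 1)^[v] =
      fun x => (S.r (i + 1) * p') * x + (S.r (i + 1) * q' + S.t (i + 1)) := by
    funext x; simp only [Function.comp, h2, f]; ring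
  rw [e1, e2] at h
  have := aux_icc (S.aux_ab hS) (mul_pos (S.hr i hi (by omega)).1 hp)
    (mul_pos (S.hr (i + 1) (by omega) hi').1 hp') h
  change (S.f i ∘ (S.f S.m)^[u]) x = (S.f (i + 1) ∘ (S.f 1)^[v]) x
  rw [e1, e2, this.1, this.2]

lemma aux_EI (S : ClassE) {x : ℝ} (hx : x ∈ S.E) : x ∈ S.I := S.aux_E_sub hx

lemma aux_claim (S : ClassE) (hS : S.goodE) {x : ℝ} (hx : x ∈ S.E) (hx' : x ∈ S.f 1 '' S.I) :
    ∃ y ∈ S.E, x = S.f 1 y := by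
  have hm := S.hm
  by_cases hne : S.f 1 '' S.I ∩ S.f (1 + 1) '' S.I = ∅
  · obtain ⟨j, y, h1, h2, h3, h4⟩ := S.aux_ex hx
    obtain ⟨z, hz, hz'⟩ := hx'
    rcases (show j = 1 ∨ j = 2 ∨ 1 + 2 ≤ j by omega) with rfl | rfl | hj
    · exact ⟨y, h3, h4⟩
    · exfalso
      have : x ∈ S.f 1 '' S.I ∩ S.f (1 + 1) '' S.I := ⟨⟨z, hz, hz'⟩, y, S.aux_EI h3, h4.symm⟩
      rw [hne] at this
      exact this
    · have := S.aux_far hS le_rfl hj h2 hz (S.aux_EI h3)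
      exfalso; linarith
  obtain ⟨u, v, hu, hv, e1, e2⟩ := hS.2.2.2 1 le_rfl (by omega) hne
  have hsw := S.aux_swap hS le_rfl (by omega) (e1.symm.trans e2)
  obtain ⟨R, h0, h1, hR⟩ := S.aux_R
  have key : ∀ n : ℕ, ∀ k : ℕ, 1 ≤ k → ∀ x ∈ S.E, x ∈ (S.f 1)^[k] '' S.I →
      ∃ w ∈ S.E, |x - (S.f 1)^[k] w| ≤ R ^ n * (S.b - S.a) := by
    intro n
    induction n with
    | zero =>
      intro k hk x hx _
      obtain ⟨w, hw⟩ := S.hEne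
      refine ⟨w, hw, ?_⟩
      have b1 := S.aux_E_sub hx
      have b2 := S.aux_E_sub (S.aux_maps le_rfl (by omega : 1 ≤ S.m) hw k)
      rw [pow_zero, one_mul, abs_le]
      constructor <;> linarith
    | succ n ih =>
      intro k hk x hx hxI
      have hcon : ∀ i, 1 ≤ i → i ≤ S.m → ∀ y z : ℝ, |y - z| ≤ R ^ n * (S.b - S.a) →
          |S.f i y - S.f i z| ≤ R ^ (n + 1) * (S.b - S.a) := by
        intro i hi hi' y z hyz
        have e : S.f i y - S.f i z = S.r i * (y - z) := by simp only [f]; ring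
        rw [e, abs_mul, pow_succ', mul_assoc, abs_of_pos (S.hr _ hi hi').1]
        have := hR i hi hi'
        gcongr
      have hpos : 0 ≤ R ^ (n + 1) * (S.b - S.a) :=
        mul_nonneg (pow_nonneg h0 _) (by linarith [S.aux_ab hS])
      obtain ⟨z, hz, hzx⟩ := hxI
      obtain ⟨k, rfl⟩ : ∃ l, k = l + 1 := ⟨k - 1, by omega⟩
      rw [Function.iterate_succ_apply'] at hzx
      obtain ⟨j, y, g1, g2, g3, g4⟩ := S.aux_ex hx
      have hzk : (S.f 1)^[k] z ∈ S.I := S.aux_I_iter le_rfl (by omega) hz k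
      rcases (show j = 1 ∨ j = 2 ∨ 1 + 2 ≤ j by omega) with rfl | rfl | hj
      · rcases Nat.eq_zero_or_pos k with rfl | hk0
        · refine ⟨y, g3, ?_⟩
          simpa [g4] using hpos
        · have hy : (S.f 1)^[k] z = y := S.aux_inj 1 le_rfl g2 (hzx.trans g4)
          obtain ⟨w, hw, hw'⟩ := ih k hk0 y g3 ⟨z, hz, hy⟩
          refine ⟨w, hw, ?_⟩
          rw [Function.iterate_succ_apply', g4]
          exact hcon 1 le_rfl g2 _ _ hw'
      · have hmem : x ∈ S.f 1 '' S.I ∩ S.f (1 + 1) '' S.I :=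
          ⟨⟨_, hzk, hzx⟩, y, S.aux_EI g3, g4.symm⟩
        rcases Nat.eq_zero_or_pos k with rfl | hk0
        · rw [e2] at hmem
          obtain ⟨s, hs, hs'⟩ := hmem
          have hy : (S.f 1)^[v] s = y := S.aux_inj 2 g1 g2 (hs'.trans g4)
          obtain ⟨w, hw, hw'⟩ := ih v hv y g3 ⟨s, hs, hy⟩
          refine ⟨(S.f S.m)^[u] w, S.aux_maps (by omega) le_rfl hw u, ?_⟩
          change |x - S.f 1 ((S.f S.m)^[u] w)| ≤ _
          rw [hsw, g4]
          exact hcon 2 g1 g2 _ _ hw'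
        · exfalso
          rw [e1] at hmem
          obtain ⟨s, hs, hs'⟩ := hmem
          have hy : (S.f S.m)^[u] s = (S.f 1)^[k] z :=
            S.aux_inj 1 le_rfl (by omega) (hs'.trans hzx.symm)
          obtain ⟨k, rfl⟩ : ∃ l, k = l + 1 := ⟨k - 1, by omega⟩
          obtain ⟨u, rfl⟩ : ∃ l, u = l + 1 := ⟨u - 1, by omega⟩
          rw [Function.iterate_succ_apply', Function.iterate_succ_apply'] at hy
          have := S.aux_far hS le_rfl (by omega : 1 + 2 ≤ S.m) le_rfl
            (S.aux_I_iter le_rfl (by omega) hz k)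
            (S.aux_I_iter (by omega : 1 ≤ S.m) le_rfl hs u)
          linarith
      · have := S.aux_far hS le_rfl hj g2 hzk (S.aux_EI g3)
        exfalso; linarith
  have hcl : IsClosed (S.f 1 '' S.E) := (S.hEcpt.image (S.aux_cont 1)).isClosed
  have : x ∈ closure (S.f 1 '' S.E) := by
    rw [Metric.mem_closure_iff]
    intro ε hε
    have ht : Tendsto (fun n => R ^ n * (S.b - S.a)) atTop (nhds 0) := by
      simpa using (tendsto_pow_atTop_nhds_zero_of_lt_one h0 h1).mul_const (S.b - S.a)
    obtain ⟨n, hn⟩ := (ht.eventually (gt_mem_nhds hε)).exists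
    obtain ⟨w, hw, hw'⟩ := key n 1 le_rfl x hx (by simpa using hx')
    exact ⟨S.f 1 w, ⟨w, hw, rfl⟩, by rw [Real.dist_eq]; exact lt_of_le_of_lt hw' hn⟩
  rw [hcl.closure_eq] at this
  obtain ⟨y, hy, hy'⟩ := this
  exact ⟨y, hy, hy'.symm⟩

/-- Univoque points whose coding does not start with `1`. -/
def aux_W (S : ClassE) : Set ℝ :=
  {x | x ∈ S.U 1 ∧ ∃ j y, 2 ≤ j ∧ j ≤ S.m ∧ y ∈ S.E ∧ x = S.f j y}

lemma aux_W_not (S : ClassE) (hS : S.goodE) {x : ℝ} (hx : x ∈ S.aux_W) : x ∉ S.f 1 '' S.I := by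
  intro h
  obtain ⟨hU, j, y, h1, h2, h3, h4⟩ := hx
  obtain ⟨z, hz, hz'⟩ := S.aux_claim hS hU.1 h
  have := S.aux_head (by omega) h2 le_rfl (by omega) hU h3 hz h4 hz'
  omega

lemma aux_strip (S : ClassE) (k : ℕ) : ∀ x ∈ S.U 1, ∀ d, S.isCoding d x → d k ≠ 1 →
    ∃ n, x ∈ (S.f 1)^[n] '' S.aux_W := by
  have hm := S.hm
  induction k with
  | zero =>
    intro x hx d hd h
    obtain ⟨y, h1, h2⟩ := S.aux_coding_tail hd
    have := hd.1 0
    exact ⟨0, x, ⟨hx, d 0, y, by omega, this.2, S.aux_coding_mem h2, h1⟩, rfl⟩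
  | succ k ih =>
    intro x hx d hd h
    obtain ⟨y, h1, h2⟩ := S.aux_coding_tail hd
    have hd0 := hd.1 0
    by_cases h0 : d 0 = 1
    · rw [h0] at h1
      obtain ⟨n, w, hw, hw'⟩ := ih y (S.aux_U_down le_rfl (by omega) (S.aux_coding_mem h2)
        (h1 ▸ hx)) _ h2 h
      refine ⟨n + 1, w, hw, ?_⟩
      rw [Function.iterate_succ_apply', hw', h1]
    · exact ⟨0, x, ⟨hx, d 0, y, by omega, hd0.2, S.aux_coding_mem h2, h1⟩, rfl⟩

lemma aux_push (S : ClassE) (hS : S.goodE)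
    (h : S.f (S.m - 1) '' S.I ∩ S.f S.m '' S.I = ∅) {y : ℝ} (hy : y ∈ S.aux_W) :
    S.f (S.m - 1) y ∈ S.U 1 := by
  have hm := S.hm
  have hyE : y ∈ S.E := hy.1.1
  have hyI := S.aux_EI hyE
  have hyU := (S.aux_U y).1 hy.1
  have main : ∀ d, S.isCoding d (S.f (S.m - 1) y) →
      d 0 = S.m - 1 ∧ S.isCoding (fun k => d (k + 1)) y := by
    intro d hd
    obtain ⟨z, hz, hz'⟩ := S.aux_coding_tail hd
    have hzI := S.aux_EI (S.aux_coding_mem hz')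
    have hd0 := hd.1 0
    have h0 : d 0 = S.m - 1 := by
      by_contra hc
      rcases (show d 0 = S.m ∨ d 0 + 2 ≤ S.m - 1 ∨ d 0 = S.m - 2 by omega) with e | e | e
      · have : S.f (S.m - 1) y ∈ S.f (S.m - 1) '' S.I ∩ S.f S.m '' S.I :=
          ⟨⟨y, hyI, rfl⟩, z, hzI, by rw [hz, e]⟩
        rw [h] at this
        exact this
      · have := S.aux_far hS hd0.1 e (by omega) hzI hyI
        linarith
      · have e' : S.m - 2 + 1 = S.m - 1 := by omega
        have hmem : S.f (S.m - 1) y ∈ S.f (S.m - 2) '' S.I ∩ S.f (S.m - 2 + 1) '' S.I := by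
          rw [e']
          exact ⟨⟨z, hzI, by rw [hz, e]⟩, y, hyI, rfl⟩
        obtain ⟨u, v, hu, hv, e1, e2⟩ := hS.2.2.2 (S.m - 2) (by omega) (by omega)
          (Set.nonempty_iff_ne_empty.1 ⟨_, hmem⟩)
        rw [e2, e'] at hmem
        obtain ⟨s, hs, hs'⟩ := hmem
        have hsy : (S.f 1)^[v] s = y := S.aux_inj (S.m - 1) (by omega) (by omega) hs'
        obtain ⟨v, rfl⟩ : ∃ l, v = l + 1 := ⟨v - 1, by omega⟩
        rw [Function.iterate_succ_apply'] at hsy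
        exact S.aux_W_not hS hy ⟨_, S.aux_I_iter le_rfl (by omega) hs v, hsy⟩
    refine ⟨h0, ?_⟩
    rw [h0] at hz
    rw [S.aux_inj (S.m - 1) (by omega) (by omega) hz]
    exact hz'
  rw [aux_U]
  refine ⟨S.aux_mem (by omega) (by omega) hyE, fun c d hc hd => ?_⟩
  obtain ⟨c1, c2⟩ := main c hc
  obtain ⟨d1, d2⟩ := main d hd
  funext n
  cases n with
  | zero => rw [c1, d1]
  | succ n => exact congrFun (hyU.2 _ _ c2 d2) n

lemma aux_lip (S : ClassE) (i : ℕ) : LipschitzWith ‖S.r i‖₊ (S.f i) := by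
  refine LipschitzWith.of_dist_le_mul fun x y => ?_
  have e : S.f i x - S.f i y = S.r i * (x - y) := by simp only [f]; ring
  rw [Real.dist_eq, e, abs_mul, Real.dist_eq]; rfl

lemma aux_alip (S : ClassE) (i : ℕ) (hi : 1 ≤ i) (hi' : i ≤ S.m) :
    AntilipschitzWith ‖S.r i‖₊⁻¹ (S.f i) := by
  refine AntilipschitzWith.of_le_mul_dist fun x y => ?_
  have e : S.f i x - S.f i y = S.r i * (x - y) := by simp only [f]; ring
  have hr := (S.hr i hi hi').1
  rw [Real.dist_eq, Real.dist_eq, e, abs_mul, NNReal.coe_inv, coe_nnnorm, Real.norm_eq_abs,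
    inv_mul_cancel_left₀ (abs_pos.2 hr.ne').ne']

end ClassE

theorem stmt8 (S : ClassE) (hS : S.goodE)
    (h : S.f (S.m - 1) '' S.I ∩ S.f S.m '' S.I = ∅) :
    dimH (S.f (S.m - 1) '' S.E ∩ S.U 1) = dimH (S.U 1) := by
  have hm := S.hm
  refine le_antisymm (dimH_mono inter_subset_right) ?_
  have hsub : S.U 1 ⊆ {x | S.isCoding (fun _ => 1) x} ∪ ⋃ n : ℕ, (S.f 1)^[n] '' S.aux_W := by
    intro x hx
    obtain ⟨d, hd⟩ := S.aux_coding_exists hx.1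
    by_cases hall : ∀ k, d k = 1
    · left
      have : d = fun _ => 1 := funext hall
      rw [this] at hd
      exact hd
    · push Not at hall
      obtain ⟨k, hk⟩ := hall
      right
      exact mem_iUnion.2 (S.aux_strip k x hx d hd hk)
  have hss : ({x | S.isCoding (fun _ => 1) x} : Set ℝ).Subsingleton :=
    fun x hx y hy => tendsto_nhds_unique hx.2 hy.2
  have h1 : dimH (S.U 1) ≤ dimH S.aux_W := by
    refine (dimH_mono hsub).trans ?_
    rw [dimH_union, hss.dimH_zero, dimH_iUnion]
    refine max_le zero_le (iSup_le fun n => ?_)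
    exact ((S.aux_lip 1).iterate n).dimH_image_le _
  refine h1.trans (((S.aux_alip (S.m - 1) (by omega) (by omega)).le_dimH_image _).trans
    (dimH_mono ?_))
  rintro _ ⟨y, hy, rfl⟩
  exact ⟨⟨y, hy.1.1, rfl⟩, S.aux_push hS h hy⟩
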